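/- Let S be a finite thick generalized quadrangle in which Ẽ(x) is nontrivial for every point x, and let r be a prime with P_r = {y : r divides |Ẽ(y)|} nonempty. If L_r, the set of lines incident with at least two points of P_r, is nonempty, then every point of P_r is incident with at least two lines of L_r. -/

import Mathlib

open Equiv

section GQDefs

variable {P L : Type*}

/-- A generalized quadrangle of order `(s,t)`: every line has `s+1` points, every point is
on `t+1` lines, two distinct points are on at most one common line, and for every
non-incident point-line pair `(p, ℓ)` there is a unique pair `(q, M)` with `M` a line
through `p` and `q` a point incident with both `M` and `ℓ`. -/
structure IsGQ (I : P → L → Prop) (s t : ℕ) : Prop where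
  point_count : ∀ ℓ : L, Nat.card {p : P // I p ℓ} = s + 1
  line_count : ∀ p : P, Nat.card {ℓ : L // I p ℓ} = t + 1
  unique_line : ∀ ⦃p q : P⦄, p ≠ q → ∀ ⦃ℓ m : L⦄, I p ℓ → I q ℓ → I p m → I q m → ℓ = m
  quad : ∀ ⦃p : P⦄ ⦃ℓ : L⦄, ¬ I p ℓ →
    ∃! qM : P × L, I p qM.2 ∧ I qM.1 qM.2 ∧ I qM.1 ℓ

/-- Two points are collinear if some line is incident with both. -/
def Coll (I : P → L → Prop) (x y : P) : Prop := ∃ ℓ : L, I x ℓ ∧ I y ℓ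

/-- The automorphism group of an incidence structure, as a subgroup of
`Perm P × Perm L`: pairs of permutations preserving incidence. -/
def autGroup (I : P → L → Prop) : Subgroup (Perm P × Perm L) where
  carrier := {g | ∀ p ℓ, I (g.1 p) (g.2 ℓ) ↔ I p ℓ}
  one_mem' := fun _ _ => Iff.rfl
  mul_mem' := fun {a b} ha hb p ℓ => (ha (b.1 p) (b.2 ℓ)).trans (hb p ℓ)
  inv_mem' := by
    intro a ha p ℓ
    have h := ha (a⁻¹.1 p) (a⁻¹.2 ℓ)
    simpa using h.symm

/-- The full group `Ẽ(p)` of symmetries with center `p`: automorphisms fixing every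
point collinear with `p`. -/
def symmGroup (I : P → L → Prop) (p : P) : Subgroup (Perm P × Perm L) where
  carrier := {g | g ∈ autGroup I ∧ ∀ y : P, Coll I p y → g.1 y = y}
  one_mem' := ⟨(autGroup I).one_mem, fun _ _ => rfl⟩
  mul_mem' := by
    rintro a b ⟨ha, ha'⟩ ⟨hb, hb'⟩
    refine ⟨(autGroup I).mul_mem ha hb, fun y hy => ?_⟩
    have : (a * b).1 y = a.1 (b.1 y) := rfl
    rw [this, hb' y hy, ha' y hy]
  inv_mem' := by
    rintro a ⟨ha, ha'⟩
    refine ⟨(autGroup I).inv_mem ha, fun y hy => ?_⟩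
    have h : a⁻¹.1 (a.1 y) = y := by simp
    rw [ha' y hy] at h
    exact h

/-- `x^⊥`: the set of points collinear with `x` (including `x` itself). -/
def perpSet (I : P → L → Prop) (x : P) : Set P := {y | Coll I x y}

/-- The hyperbolic line `{x,y}^{⊥⊥}`: points collinear with every point of
`{x,y}^⊥ = x^⊥ ∩ y^⊥`. -/
def hypLine (I : P → L → Prop) (x y : P) : Set P :=
  {z | ∀ w ∈ perpSet I x ∩ perpSet I y, Coll I z w}

/-- The group `G` generated by all the point-symmetries of the quadrangle. -/
def bigGroup (I : P → L → Prop) : Subgroup (Perm P × Perm L) :=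
  ⨆ x : P, symmGroup I x

/-- The set `P_r` of `r`-points: points whose full group of symmetries has order
divisible by `r`. -/
def Pr (I : P → L → Prop) (r : ℕ) : Set P :=
  {y | r ∣ Nat.card (symmGroup I y)}

/-- The set `L_r` of lines incident with at least two points of `P_r`. -/
def Lr (I : P → L → Prop) (r : ℕ) : Set L :=
  {ℓ | ∃ x y : P, x ≠ y ∧ x ∈ Pr I r ∧ y ∈ Pr I r ∧ I x ℓ ∧ I y ℓ}

/-- The stabilizer `G_u` of a point `u` in a group `G` of automorphisms. -/
def stabPt (G : Subgroup (Perm P × Perm L)) (u : P) : Subgroup (Perm P × Perm L) where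
  carrier := {g | g ∈ G ∧ g.1 u = u}
  one_mem' := ⟨G.one_mem, rfl⟩
  mul_mem' := by
    rintro a b ⟨ha, ha'⟩ ⟨hb, hb'⟩
    refine ⟨G.mul_mem ha hb, ?_⟩
    have : (a * b).1 u = a.1 (b.1 u) := rfl
    rw [this, hb', ha']
  inv_mem' := by
    rintro a ⟨ha, ha'⟩
    refine ⟨G.inv_mem ha, ?_⟩
    have h : a⁻¹.1 (a.1 u) = u := by simp
    rw [ha'] at h
    exact h

/-- The setwise stabilizer `G_ℓ` of a line `ℓ` in a group `G` of automorphisms. -/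
def stabLine (G : Subgroup (Perm P × Perm L)) (ℓ : L) : Subgroup (Perm P × Perm L) where
  carrier := {g | g ∈ G ∧ g.2 ℓ = ℓ}
  one_mem' := ⟨G.one_mem, rfl⟩
  mul_mem' := by
    rintro a b ⟨ha, ha'⟩ ⟨hb, hb'⟩
    refine ⟨G.mul_mem ha hb, ?_⟩
    have : (a * b).2 ℓ = a.2 (b.2 ℓ) := rfl
    rw [this, hb', ha']
  inv_mem' := by
    rintro a ⟨ha, ha'⟩
    refine ⟨G.inv_mem ha, ?_⟩
    have h : a⁻¹.2 (a.2 ℓ) = ℓ := by simp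
    rw [ha'] at h
    exact h

/-- Isomorphism of incidence structures: a pair of bijections between the point sets and
the line sets preserving incidence in both directions. -/
def IsoTo {P L P' L' : Type*} (I : P → L → Prop) (I' : P' → L' → Prop) : Prop :=
  ∃ (e : P ≃ P') (f : L ≃ L'), ∀ p ℓ, I' (e p) (f ℓ) ↔ I p ℓ

end GQDefs

section ClassicalGQs

/-- The standard nondegenerate alternating bilinear form on `F^4`. -/
def sympForm {F : Type*} [Field F] (x y : Fin 4 → F) : F :=
  x 0 * y 1 - x 1 * y 0 + x 2 * y 3 - x 3 * y 2

/-- Points of `W(3,q)`: the `1`-dimensional subspaces of `F_q^4`. -/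
def W3Point (F : Type*) [Field F] : Type _ :=
  {W : Submodule F (Fin 4 → F) // Module.finrank F W = 1}

/-- Lines of `W(3,q)`: the `2`-dimensional totally isotropic subspaces of `F_q^4` with
respect to a nondegenerate alternating form. -/
def W3Line (F : Type*) [Field F] : Type _ :=
  {U : Submodule F (Fin 4 → F) //
    Module.finrank F U = 2 ∧ ∀ x ∈ U, ∀ y ∈ U, sympForm x y = 0}

/-- Incidence in `W(3,q)` is given by inclusion. -/
def W3Incid (F : Type*) [Field F] : W3Point F → W3Line F → Prop :=
  fun W U => W.1 ≤ U.1

/-- The standard nondegenerate Hermitian sesquilinear form on `F_{q²}^4`, relative to the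
field automorphism `x ↦ x^q`. -/
def hermForm3 {F : Type*} [Field F] (q : ℕ) (x y : Fin 4 → F) : F :=
  x 0 * y 1 ^ q + x 1 * y 0 ^ q + x 2 * y 3 ^ q + x 3 * y 2 ^ q

/-- The standard nondegenerate Hermitian sesquilinear form on `F_{q²}^5`, relative to the
field automorphism `x ↦ x^q`. -/
def hermForm4 {F : Type*} [Field F] (q : ℕ) (x y : Fin 5 → F) : F :=
  x 0 * y 1 ^ q + x 1 * y 0 ^ q + x 2 * y 3 ^ q + x 3 * y 2 ^ q + x 4 * y 4 ^ q

/-- Points of `H(3,q²)`: the `1`-dimensional isotropic subspaces of `F_{q²}^4`. -/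
def H3Point (F : Type*) [Field F] (q : ℕ) : Type _ :=
  {W : Submodule F (Fin 4 → F) //
    Module.finrank F W = 1 ∧ ∀ x ∈ W, hermForm3 q x x = 0}

/-- Lines of `H(3,q²)`: the `2`-dimensional totally isotropic subspaces of `F_{q²}^4`. -/
def H3Line (F : Type*) [Field F] (q : ℕ) : Type _ :=
  {U : Submodule F (Fin 4 → F) //
    Module.finrank F U = 2 ∧ ∀ x ∈ U, ∀ y ∈ U, hermForm3 q x y = 0}

/-- Incidence in `H(3,q²)` is given by inclusion. -/
def H3Incid (F : Type*) [Field F] (q : ℕ) : H3Point F q → H3Line F q → Prop :=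
  fun W U => W.1 ≤ U.1

/-- Points of `H(4,q²)`: the `1`-dimensional isotropic subspaces of `F_{q²}^5`. -/
def H4Point (F : Type*) [Field F] (q : ℕ) : Type _ :=
  {W : Submodule F (Fin 5 → F) //
    Module.finrank F W = 1 ∧ ∀ x ∈ W, hermForm4 q x x = 0}

/-- Lines of `H(4,q²)`: the `2`-dimensional totally isotropic subspaces of `F_{q²}^5`. -/
def H4Line (F : Type*) [Field F] (q : ℕ) : Type _ :=
  {U : Submodule F (Fin 5 → F) //
    Module.finrank F U = 2 ∧ ∀ x ∈ U, ∀ y ∈ U, hermForm4 q x y = 0}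

/-- Incidence in `H(4,q²)` is given by inclusion. -/
def H4Incid (F : Type*) [Field F] (q : ℕ) : H4Point F q → H4Line F q → Prop :=
  fun W U => W.1 ≤ U.1

end ClassicalGQs

section Helpers

variable {P L : Type} {I : P → L → Prop} {s t : ℕ}

theorem Coll.symm {x y : P} (h : Coll I x y) : Coll I y x :=
  let ⟨ℓ, h₁, h₂⟩ := h
  ⟨ℓ, h₂, h₁⟩

namespace IsGQ

/-- A point off a line is joined to at most one point of it. -/
theorem eq_of_join (h : IsGQ I s t) {p q q' : P} {ℓ M M' : L} (hp : ¬ I p ℓ)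
    (hM : I p M) (hqM : I q M) (hq : I q ℓ) (hM' : I p M') (hqM' : I q' M') (hq' : I q' ℓ) :
    q = q' ∧ M = M' := by
  have := (h.quad hp).unique (y₁ := (q, M)) (y₂ := (q', M')) ⟨hM, hqM, hq⟩ ⟨hM', hqM', hq'⟩
  exact ⟨congrArg Prod.fst this, congrArg Prod.snd this⟩

/-- Three pairwise collinear points, two of them distinct on `ℓ`, are all on `ℓ`. -/
theorem mem_of_coll (h : IsGQ I s t) {p q q' : P} {ℓ : L} (hq : I q ℓ) (hq' : I q' ℓ)
    (hne : q ≠ q') (hpq : Coll I p q) (hpq' : Coll I p q') : I p ℓ := by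
  by_contra hp
  obtain ⟨M, hM, hqM⟩ := hpq
  obtain ⟨M', hM', hqM'⟩ := hpq'
  exact hne (h.eq_of_join hp hM hqM hq hM' hqM' hq').1

theorem exists_proj (h : IsGQ I s t) (p : P) (ℓ : L) : ∃ q, I q ℓ ∧ Coll I p q := by
  by_cases hp : I p ℓ
  · exact ⟨p, hp, ℓ, hp, hp⟩
  · obtain ⟨⟨q, M⟩, ⟨hM, hqM, hq⟩, -⟩ := h.quad hp
    exact ⟨q, hq, M, hM, hqM⟩

theorem exists_point_ne_ne (h : IsGQ I s t) (hs : 2 ≤ s) (ℓ : L) (a b : P) :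
    ∃ q, I q ℓ ∧ q ≠ a ∧ q ≠ b := by
  by_contra! hc
  have hsub : {p : P | I p ℓ} ⊆ {a, b} := fun p hp => by
    by_cases hpa : p = a
    · exact Or.inl hpa
    · exact Or.inr (hc p hp hpa)
  have h₁ := Set.ncard_le_ncard hsub (Set.toFinite _)
  have h₂ : Set.ncard {p : P | I p ℓ} = s + 1 := h.point_count ℓ
  have h₃ := Set.ncard_insert_le a {b}
  rw [Set.ncard_singleton] at h₃
  omega

theorem exists_line_ne (h : IsGQ I s t) (ht : 2 ≤ t) (p : P) (M : L) :
    ∃ N, I p N ∧ N ≠ M := by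
  by_contra! hc
  have hsub : {ℓ : L | I p ℓ} ⊆ {M} := fun ℓ hℓ => hc ℓ hℓ
  have h₁ := Set.ncard_le_ncard hsub (Set.toFinite _)
  have h₂ : Set.ncard {ℓ : L | I p ℓ} = t + 1 := h.line_count p
  rw [Set.ncard_singleton] at h₁
  omega

theorem exists_line (h : IsGQ I s t) (p : P) : ∃ ℓ, I p ℓ := by
  by_contra! hc
  have h₂ : Set.ncard {ℓ : L | I p ℓ} = t + 1 := h.line_count p
  simp [hc] at h₂

theorem coll_self (h : IsGQ I s t) (p : P) : Coll I p p :=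
  let ⟨ℓ, hℓ⟩ := h.exists_line p
  ⟨ℓ, hℓ, hℓ⟩

/-- A point collinear with every point of `{u,x}^⊥`, where `u` and `x` are not collinear,
is collinear with `u` only if it is `u`. -/
theorem eq_of_mem_hypLine (h : IsGQ I s t) (ht : 2 ≤ t) {u x y : P}
    (hux : ¬ Coll I u x) (hy : y ∈ hypLine I u x) (huy : Coll I u y) : y = u := by
  by_contra hyu
  obtain ⟨M, huM, hyM⟩ := huy
  obtain ⟨N, huN, hNM⟩ := h.exists_line_ne ht u M
  obtain ⟨c, hcN, hxc⟩ := h.exists_proj x N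
  have hcu : c ≠ u := by
    rintro rfl
    exact hux hxc.symm
  have hyN := h.mem_of_coll huN hcN hcu.symm ⟨M, hyM, huM⟩ (hy c ⟨⟨N, huN, hcN⟩, hxc⟩)
  exact hNM (h.unique_line hyu hyN huN hyM huM)

theorem line_fixed (h : IsGQ I s t) {g : Perm P × Perm L} (hg : g ∈ autGroup I) {p q : P}
    {ℓ : L} (hpq : p ≠ q) (hp : I p ℓ) (hq : I q ℓ) (hgp : g.1 p = p) (hgq : g.1 q = q) :
    g.2 ℓ = ℓ := by
  have h₁ := (hg p ℓ).2 hp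
  have h₂ := (hg q ℓ).2 hq
  rw [hgp] at h₁
  rw [hgq] at h₂
  exact h.unique_line hpq h₁ h₂ hp hq

/-- A symmetry with center `z` fixing a line fixes the points of that line not collinear
with `z`. -/
theorem point_fixed_of_line_fixed (h : IsGQ I s t) (ht : 2 ≤ t) {g : Perm P × Perm L} {z w : P}
    {M : L} (hg : g ∈ symmGroup I z) (hgM : g.2 M = M) (hw : I w M) (hzw : ¬ Coll I z w) :
    g.1 w = w := by
  obtain ⟨N, hwN, hNM⟩ := h.exists_line_ne ht w M
  obtain ⟨a, haN, hza⟩ := h.exists_proj z N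
  have haw : a ≠ w := by
    rintro rfl
    exact hzw hza
  have haM : ¬ I a M := fun haM => hNM (h.unique_line haw haN hwN haM hw)
  have h₁ := (hg.1 a N).2 haN
  rw [hg.2 a hza] at h₁
  have h₂ := (hg.1 w M).2 hw
  rw [hgM] at h₂
  exact (h.eq_of_join haM h₁ ((hg.1 w N).2 hwN) h₂ haN hwN hw).1

theorem point_fixed_of_coll (h : IsGQ I s t) (ht : 2 ≤ t) {g : Perm P × Perm L} {z y w : P}
    (hg : g ∈ symmGroup I z) (hgy : g.1 y = y) (hzy : ¬ Coll I z y) (hyw : Coll I y w) :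
    g.1 w = w := by
  by_cases hzw : Coll I z w
  · exact hg.2 w hzw
  obtain ⟨M, hyM, hwM⟩ := hyw
  obtain ⟨a, haM, hza⟩ := h.exists_proj z M
  have hay : a ≠ y := by
    rintro rfl
    exact hzy hza
  exact h.point_fixed_of_line_fixed ht hg
    (h.line_fixed hg.1 hay haM hyM (hg.2 a hza) hgy) hwM hzw

/-- A symmetry with center `z` fixing a point not collinear with `z` is trivial. -/
theorem symm_eq_one (h : IsGQ I s t) (hs : 2 ≤ s) (ht : 2 ≤ t) {g : Perm P × Perm L} {z y : P}
    (hg : g ∈ symmGroup I z) (hgy : g.1 y = y) (hzy : ¬ Coll I z y) : g = 1 := by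
  have key : ∀ w, g.1 w = w := by
    intro w
    by_cases hzw : Coll I z w
    · exact hg.2 w hzw
    by_cases hyw : Coll I y w
    · exact h.point_fixed_of_coll ht hg hgy hzy hyw
    obtain ⟨K, hwK⟩ := h.exists_line w
    obtain ⟨b, hbK, hyb⟩ := h.exists_proj y K
    by_cases hzb : Coll I z b
    · obtain ⟨B, hyB, hbB⟩ := hyb
      obtain ⟨M, hyM, hMB⟩ := h.exists_line_ne ht y B
      obtain ⟨a, haM, hza⟩ := h.exists_proj z M
      obtain ⟨q, hqM, hqa, hqy⟩ := h.exists_point_ne_ne hs M a y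
      have hyb : y ≠ b := by
        rintro rfl
        exact hzy hzb
      have hgq := h.point_fixed_of_coll ht hg hgy hzy ⟨M, hyM, hqM⟩
      have hzq : ¬ Coll I z q := by
        intro hzq
        have hzM := h.mem_of_coll hqM haM hqa hzq hza
        exact hzy ⟨M, hzM, hyM⟩
      obtain ⟨b', hb'K, hqb'⟩ := h.exists_proj q K
      have hbb' : b ≠ b' := by
        rintro rfl
        have hbM := h.mem_of_coll hqM hyM hqy hqb'.symm ⟨B, hbB, hyB⟩
        exact hMB (h.unique_line hyb hyM hbM hyB hbB)
      have hzb' : ¬ Coll I z b' := by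
        intro hzb'
        exact hzw ⟨K, h.mem_of_coll hbK hb'K hbb' hzb hzb', hwK⟩
      have hgb' := h.point_fixed_of_coll ht hg hgq hzq hqb'
      exact h.point_fixed_of_coll ht hg hgb' hzb' ⟨K, hb'K, hwK⟩
    · have hgb := h.point_fixed_of_coll ht hg hgy hzy hyb
      exact h.point_fixed_of_coll ht hg hgb hzb ⟨K, hbK, hwK⟩
  refine Prod.ext (Equiv.ext key) (Equiv.ext fun ℓ => ?_)
  obtain ⟨p, hp, -⟩ := h.exists_point_ne_ne hs ℓ z z
  obtain ⟨q, hq, hqp, -⟩ := h.exists_point_ne_ne hs ℓ p p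
  exact h.line_fixed hg.1 hqp hq hp (key q) (key p)

end IsGQ

theorem coll_map {g : Perm P × Perm L} (hg : g ∈ autGroup I) {x y : P} (h : Coll I x y) :
    Coll I (g.1 x) (g.1 y) :=
  let ⟨ℓ, hx, hy⟩ := h
  ⟨g.2 ℓ, (hg x ℓ).2 hx, (hg y ℓ).2 hy⟩

theorem conj_mem_symmGroup {g k : Perm P × Perm L} (hg : g ∈ autGroup I) {x : P}
    (hk : k ∈ symmGroup I x) : g * k * g⁻¹ ∈ symmGroup I (g.1 x) := by
  have hg' := (autGroup I).inv_mem hg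
  refine ⟨(autGroup I).mul_mem ((autGroup I).mul_mem hg hk.1) hg', fun y hy => ?_⟩
  have h₁ := coll_map hg' hy
  have h₂ : g⁻¹.1 (g.1 x) = x := by simp
  rw [h₂] at h₁
  have h₃ : (g * k * g⁻¹).1 y = g.1 (k.1 (g⁻¹.1 y)) := rfl
  rw [h₃, hk.2 _ h₁]
  simp

variable [Finite P]

/-- The number of points of a finite invariant set is congruent modulo `r` to the number
of its points fixed by a permutation of order `r`. -/
theorem ncard_modEq_ncard_fixed {r : ℕ} (hr : r.Prime) (f : Perm P) (hf : f ^ r = 1) (O : Set P)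
    (hO : ∀ y ∈ O, f y ∈ O) : O.ncard ≡ {y ∈ O | f y = y}.ncard [MOD r] := by
  classical
  have := Fact.mk hr
  have := Fintype.ofFinite P
  let F : Function.End O := Set.MapsTo.restrict f O O hO
  have hF : F ^ r ^ 1 = 1 := by
    have hpow : ∀ (n : ℕ) (y : O), ((F ^ n) y : P) = (f ^ n) y := by
      intro n
      induction n with
      | zero => intro y; rfl
      | succ n ih =>
        intro y
        rw [pow_succ, pow_succ]
        exact ih (F y)
    funext y
    refine Subtype.ext ?_
    rw [hpow, pow_one, hf]
    rfl
  have h := Equiv.Perm.card_fixedPoints_modEq hF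
  have h₁ : Fintype.card O = O.ncard := by
    rw [← Nat.card_eq_fintype_card]
    rfl
  have h₂ : Fintype.card (Function.fixedPoints F) = {y ∈ O | f y = y}.ncard := by
    rw [← Nat.card_eq_fintype_card]
    refine Nat.card_congr ⟨fun y => ⟨y.1.1, y.1.2, congrArg Subtype.val y.2⟩,
      fun y => ⟨⟨y.1, y.2.1⟩, Subtype.ext y.2.2⟩, fun _ => rfl, fun _ => rfl⟩
  rwa [h₁, h₂] at h

variable [Finite L]

theorem exists_prime_order_of_mem_Pr {r : ℕ} (hr : r.Prime) {x : P} (hx : x ∈ Pr I r) :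
    ∃ k ∈ symmGroup I x, orderOf k = r := by
  have := Fact.mk hr
  obtain ⟨k, hk⟩ := exists_prime_orderOf_dvd_card' r hx
  exact ⟨k, k.2, by simpa using hk⟩

theorem Pr_map {r : ℕ} (hr : r.Prime) {g : Perm P × Perm L} (hg : g ∈ autGroup I) {x : P}
    (hx : x ∈ Pr I r) : g.1 x ∈ Pr I r := by
  obtain ⟨k, hk, hkr⟩ := exists_prime_order_of_mem_Pr hr hx
  have h₁ : orderOf (g * k * g⁻¹) = r := by
    rw [← hkr]
    exact orderOf_injective (MulAut.conj g).toMonoidHom (MulAut.conj g).injective k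
  have h₂ := Subgroup.orderOf_dvd_natCard _ (conj_mem_symmGroup hg hk)
  rwa [h₁] at h₂

theorem Lr_map {r : ℕ} (hr : r.Prime) {g : Perm P × Perm L} (hg : g ∈ autGroup I) {ℓ : L}
    (hℓ : ℓ ∈ Lr I r) : g.2 ℓ ∈ Lr I r := by
  obtain ⟨x, y, hxy, hx, hy, hxℓ, hyℓ⟩ := hℓ
  exact ⟨g.1 x, g.1 y, fun h => hxy (g.1.injective h), Pr_map hr hg hx, Pr_map hr hg hy,
    (hg x ℓ).2 hxℓ, (hg y ℓ).2 hyℓ⟩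

/-- Two noncollinear points of `P_r` are conjugate under the automorphism group. -/
theorem IsGQ.exists_aut_map (h : IsGQ I s t) (hs : 2 ≤ s) (ht : 2 ≤ t) {r : ℕ} (hr : r.Prime)
    {u x : P} (hu : u ∈ Pr I r) (hx : x ∈ Pr I r) (hux : ¬ Coll I u x) :
    ∃ g ∈ autGroup I, g.1 x = u := by
  let O : Set P := {y | ∃ g ∈ autGroup I,
    (∀ w, Coll I u w → Coll I x w → g.1 w = w) ∧ g.1 x = y}
  have hyp : ∀ y ∈ O, ∀ w, Coll I u w → Coll I x w → Coll I y w := by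
    rintro y ⟨g, hg, hgw, rfl⟩ w huw hxw
    have := coll_map hg hxw
    rwa [hgw w huw hxw] at this
  have huO : ∀ y ∈ O, Coll I u y → y = u := fun y hy =>
    h.eq_of_mem_hypLine ht hux fun w hw => hyp y hy w hw.1 hw.2
  have hxO : ∀ y ∈ O, Coll I x y → y = x := fun y hy =>
    h.eq_of_mem_hypLine ht (fun hc => hux hc.symm) fun w hw => hyp y hy w hw.2 hw.1
  have hxmem : x ∈ O := ⟨1, (autGroup I).one_mem, fun _ _ _ => rfl, rfl⟩
  by_contra hno
  have hunot : u ∉ O := fun ⟨g, hg, _, hgx⟩ => hno ⟨g, hg, hgx⟩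
  have count : ∀ v, v ∈ Pr I r → (∀ k ∈ symmGroup I v, ∀ y ∈ O, k.1 y ∈ O) →
      (∀ y ∈ O, Coll I v y → y = v) → O.ncard ≡ {y ∈ O | y = v}.ncard [MOD r] := by
    intro v hv hmap hvO
    obtain ⟨k, hk, hkr⟩ := exists_prime_order_of_mem_Pr hr hv
    have hk1 : k ≠ 1 := by
      rintro rfl
      rw [orderOf_one] at hkr
      exact hr.one_lt.ne hkr
    have hpow : k.1 ^ r = 1 := by
      have := congrArg Prod.fst (pow_orderOf_eq_one k)
      rwa [hkr] at this
    have hset : {y ∈ O | k.1 y = y} = {y ∈ O | y = v} := by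
      ext y
      refine and_congr_right fun hy => ⟨fun hky => ?_, ?_⟩
      · by_contra hyv
        exact hk1 (h.symm_eq_one hs ht hk hky fun hc => hyv (hvO y hy hc))
      · rintro rfl
        exact hk.2 _ (h.coll_self _)
    rw [← hset]
    exact ncard_modEq_ncard_fixed hr k.1 hpow O (hmap k hk)
  have hcu := count u hu (fun k hk y ⟨g, hg, hgw, hgx⟩ => ⟨k * g, (autGroup I).mul_mem hk.1 hg,
    fun w huw hxw => (congrArg k.1 (hgw w huw hxw)).trans (hk.2 w huw), congrArg k.1 hgx⟩) huO
  have hcx := count x hx (fun k hk y ⟨g, hg, hgw, hgx⟩ => ⟨k * g, (autGroup I).mul_mem hk.1 hg,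
    fun w huw hxw => (congrArg k.1 (hgw w huw hxw)).trans (hk.2 w hxw), congrArg k.1 hgx⟩) hxO
  have h₀ : {y ∈ O | y = u} = ∅ := by
    ext y
    simp only [Set.mem_ofPred_eq, Set.mem_empty_iff_false, iff_false, not_and]
    rintro hy rfl
    exact hunot hy
  have h₁ : {y ∈ O | y = x} = {x} := by
    ext y
    simp only [Set.mem_ofPred_eq, Set.mem_singleton_iff, and_iff_right_iff_imp]
    rintro rfl
    exact hxmem
  rw [h₀, Set.ncard_empty] at hcu
  rw [h₁, Set.ncard_singleton] at hcx
  have hmod : 0 ≡ 1 [MOD r] := hcu.symm.trans hcx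
  exact hr.one_lt.ne' (Nat.dvd_one.1 ((Nat.modEq_zero_iff_dvd).1 hmod.symm))

end Helpers

/-- If `L_r` is nonempty, then every point of `P_r` is incident with at least two lines
of `L_r`. -/
theorem two_lines_of_Lr_through_rpoint {P L : Type} [Finite P] [Finite L]
    (I : P → L → Prop) (s t : ℕ) (hGQ : IsGQ I s t) (hs : 2 ≤ s) (ht : 2 ≤ t)
    (hE : ∀ x : P, symmGroup I x ≠ ⊥)
    (r : ℕ) (hr : r.Prime) (hne : (Pr I r).Nonempty) (hLr : (Lr I r).Nonempty) :
    ∀ u ∈ Pr I r, ∃ ℓ₁ ℓ₂ : L, ℓ₁ ≠ ℓ₂ ∧ ℓ₁ ∈ Lr I r ∧ ℓ₂ ∈ Lr I r ∧ I u ℓ₁ ∧ I u ℓ₂ := by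
  intro u hu
  obtain ⟨m, hm, hum⟩ : ∃ m ∈ Lr I r, I u m := by
    obtain ⟨ℓ, hℓ⟩ := hLr
    obtain ⟨x, y, hxy, hx, hy, hxℓ, hyℓ⟩ := id hℓ
    by_cases hux : Coll I u x
    · by_cases hne : u = x
      · exact ⟨ℓ, hℓ, hne ▸ hxℓ⟩
      · obtain ⟨n, hun, hxn⟩ := hux
        exact ⟨n, ⟨u, x, hne, hu, hx, hun, hxn⟩, hun⟩
    · obtain ⟨g, hg, hgx⟩ := hGQ.exists_aut_map hs ht hr hu hx hux
      exact ⟨g.2 ℓ, Lr_map hr hg hℓ, hgx ▸ (hg x ℓ).2 hxℓ⟩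
  obtain ⟨N, huN, hNm⟩ := hGQ.exists_line_ne ht u m
  obtain ⟨z, hzN, hzu, -⟩ := hGQ.exists_point_ne_ne hs N u u
  obtain ⟨g, hg, hg1⟩ := (symmGroup I z).ne_bot_iff_exists_ne_one.1 (hE z) |>.elim
    fun g hg => (⟨g.1, g.2, fun h => hg (Subtype.ext h)⟩ : ∃ g ∈ symmGroup I z, g ≠ 1)
  have hgu : g.1 u = u := hg.2 u ⟨N, hzN, huN⟩
  refine ⟨m, g.2 m, fun hgm => hg1 ?_, hm, Lr_map hr hg.1 hm, hum, ?_⟩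
  · obtain ⟨y, hym, hyu, -⟩ := hGQ.exists_point_ne_ne hs m u u
    have hzy : ¬ Coll I z y := fun hzy =>
      hNm (hGQ.unique_line hzu hzN huN
        (hGQ.mem_of_coll hum hym hyu.symm ⟨N, hzN, huN⟩ hzy) hum)
    exact hGQ.symm_eq_one hs ht hg
      (hGQ.point_fixed_of_line_fixed ht hg hgm.symm hym hzy) hzy
  · have := (hg.1 u m).2 hum
    rwa [hgu] at this
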